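/- arXiv:1706.04377 — 4 statements merged into one kernel-verified Lean document; each statement's English description precedes it below -/
import Mathlib

section
/- Let p ≥ 1 and let A be the (p+1)×(p+1) companion-type integer matrix with A_{0,0} = 2, A_{0,p} = 1, A_{i,i−1} = 1 for 1 ≤ i ≤ p, and all other entries 0. Then for every integer n ≥ p, the entries of A^n are given by generalized Pell (p,p)-numbers: (A^n)_{i,0} = P_p^{(p)}(n + p + 1 − i) for all 0 ≤ i ≤ p, and (A^n)_{i,j} = P_p^{(p)}(n + j − i) for all 0 ≤ i ≤ p and 1 ≤ j ≤ p. -/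
/-- The generalized Pell `(p,i)`-numbers: `P_p^{(i)}(1) = ⋯ = P_p^{(i)}(i) = 0`,
`P_p^{(i)}(i+1) = ⋯ = P_p^{(i)}(p+1) = 1`, and
`P_p^{(i)}(n) = 2 P_p^{(i)}(n-1) + P_p^{(i)}(n-p-1)` for `n > p + 1`. -/
def gpell (p i : ℕ) (n : ℕ) : ℤ :=
  if n = 0 then 0
  else if n ≤ i then 0
  else if n ≤ p + 1 then 1
  else 2 * gpell p i (n - 1) + gpell p i (n - p - 1)
termination_by n
decreasing_by all_goals omega

/-- The `(p+1) × (p+1)` companion-type matrix `A` with `A 0 0 = 2`,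
`A 0 p = 1`, `A i (i-1) = 1` for `1 ≤ i ≤ p`, and all other entries `0`. -/
def pellCompanion (p : ℕ) : Matrix (Fin (p + 1)) (Fin (p + 1)) ℤ :=
  fun i j =>
    if (i : ℕ) = 0 ∧ (j : ℕ) = 0 then 2
    else if (i : ℕ) = 0 ∧ (j : ℕ) = p then 1
    else if (i : ℕ) = (j : ℕ) + 1 then 1
    else 0

theorem gpell_eq_zero (p m : ℕ) (h : m ≤ p) : gpell p p m = 0 := by
  rw [gpell]
  simp [h]

theorem gpell_succ_self (p : ℕ) : gpell p p (p + 1) = 1 := by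
  rw [gpell]
  simp

theorem gpell_rec (p m : ℕ) (h : p + 1 < m) :
    gpell p p m = 2 * gpell p p (m - 1) + gpell p p (m - p - 1) := by
  rw [gpell, if_neg (by omega), if_neg (by omega), if_neg (by omega)]

/-- The generalized Pell `(p,p)`-numbers continued backwards along their recurrence and
reindexed so that index `k` carries the term `k - p`. -/
def shiftedGpell (p k : ℕ) : ℤ := if k = p then 1 else gpell p p (k - p)

theorem shiftedGpell_rec (p k : ℕ) (hp : 1 ≤ p) (hk : 1 ≤ k) :
    shiftedGpell p (k + p + 1) = 2 * shiftedGpell p (k + p) + shiftedGpell p k := by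
  unfold shiftedGpell
  rw [if_neg (by omega), if_neg (by omega), show k + p + 1 - p = k + 1 by omega,
    show k + p - p = k by omega]
  rcases lt_trichotomy k p with h | rfl | h
  · rw [if_neg (by omega), gpell_eq_zero _ _ (by omega), gpell_eq_zero _ _ (by omega),
      gpell_eq_zero _ _ (by omega)]
    norm_num
  · rw [if_pos rfl, gpell_succ_self, gpell_eq_zero _ _ le_rfl]
    norm_num
  · rw [if_neg (by omega), gpell_rec _ _ (by omega), show k + 1 - 1 = k by omega,
      show k + 1 - p - 1 = k - p by omega]

theorem pellCompanion_mul_zero (p : ℕ) (hp : 1 ≤ p)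
    (X : Matrix (Fin (p + 1)) (Fin (p + 1)) ℤ) (j : Fin (p + 1)) :
    (pellCompanion p * X) 0 j = 2 * X 0 j + X (Fin.last p) j := by
  have hne : (0 : Fin (p + 1)) ≠ Fin.last p := by
    simp [Fin.ext_iff]
    omega
  rw [Matrix.mul_apply, Fintype.sum_eq_add _ _ hne]
  · simp [pellCompanion, show p ≠ 0 by omega]
  · rintro x ⟨h₀, h₁⟩
    simp only [ne_eq, Fin.ext_iff, Fin.val_zero, Fin.val_last] at h₀ h₁
    simp [pellCompanion, h₀, h₁]

theorem pellCompanion_mul_succ (p : ℕ)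
    (X : Matrix (Fin (p + 1)) (Fin (p + 1)) ℤ) (i : Fin p) (j : Fin (p + 1)) :
    (pellCompanion p * X) i.succ j = X i.castSucc j := by
  rw [Matrix.mul_apply, Fintype.sum_eq_single i.castSucc]
  · simp [pellCompanion]
  · intro x hx
    have : (i : ℕ) ≠ x := fun h => hx (Fin.ext h.symm)
    simp [pellCompanion, this]

theorem pellCompanion_pow_apply (p : ℕ) (hp : 1 ≤ p) (n : ℕ) (i j : Fin (p + 1)) :
    (pellCompanion p ^ n) i j =
      shiftedGpell p (n + p + (if (j : ℕ) = 0 then p + 1 else j) - i) := by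
  induction n generalizing i with
  | zero =>
    rw [pow_zero, Matrix.one_apply, shiftedGpell]
    simp only [Fin.ext_iff]
    have hi := i.is_lt
    have hj := j.is_lt
    by_cases h : (i : ℕ) = j
    · rw [if_pos h]
      by_cases h₀ : (j : ℕ) = 0
      · rw [if_pos h₀, if_neg (by omega), show 0 + p + (p + 1) - (i : ℕ) - p = p + 1 by omega,
          gpell_succ_self]
      · rw [if_neg h₀, if_pos (by omega)]
    · rw [if_neg h]
      split_ifs
      · omega
      · exact (gpell_eq_zero _ _ (by omega)).symm
      · omega
      · exact (gpell_eq_zero _ _ (by omega)).symm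
  | succ n ih =>
    rw [pow_succ']
    obtain ⟨c, hc⟩ : ∃ c, c = if (j : ℕ) = 0 then p + 1 else (j : ℕ) := ⟨_, rfl⟩
    have hc₁ : 1 ≤ c := by
      rw [hc]
      split_ifs <;> omega
    rw [← hc] at ih ⊢
    cases i using Fin.cases with
    | zero =>
      rw [pellCompanion_mul_zero p hp, ih, ih, Fin.val_zero, Fin.val_last,
        show n + 1 + p + c - 0 = (n + c) + p + 1 by omega, shiftedGpell_rec p _ hp (by omega),
        show n + p + c - 0 = n + c + p by omega, show n + p + c - p = n + c by omega]
    | succ i =>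
      rw [pellCompanion_mul_succ, ih, Fin.val_castSucc, Fin.val_succ,
        show n + 1 + p + c - (i + 1) = n + p + c - i by omega]

/-- For `p ≥ 1` and `n ≥ p`, the entries of `A^n` are generalized Pell
`(p,p)`-numbers: `(A^n)_{i,0} = P_p^{(p)}(n+p+1-i)` and, for `1 ≤ j ≤ p`,
`(A^n)_{i,j} = P_p^{(p)}(n+j-i)`. -/
theorem pellCompanion_pow_entries (p n : ℕ) (hp : 1 ≤ p) (hn : p ≤ n) :
    (∀ i : Fin (p + 1),
        (pellCompanion p ^ n) i 0 = gpell p p (n + p + 1 - (i : ℕ))) ∧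
    (∀ i j : Fin (p + 1), 1 ≤ (j : ℕ) →
        (pellCompanion p ^ n) i j = gpell p p (n + (j : ℕ) - (i : ℕ))) := by
  have key (i j : Fin (p + 1)) : (pellCompanion p ^ n) i j =
      gpell p p (n + (if (j : ℕ) = 0 then p + 1 else j) - i) := by
    have hi := i.is_lt
    rw [pellCompanion_pow_apply p hp, shiftedGpell, if_neg (by split_ifs <;> omega)]
    congr 1
    omega
  refine ⟨fun i => ?_, fun i j hj => ?_⟩
  · rw [key, Fin.val_zero, if_pos rfl, add_assoc]
  · rw [key, if_neg (by omega)]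
end

section
/- Let p ≥ 1, n ≥ 1, let A be the (p+1)×(p+1) companion-type integer matrix with A_{0,0} = 2, A_{0,p} = 1, A_{i,i−1} = 1 for 1 ≤ i ≤ p, and all other entries 0, and let G_n = A^n. Then for every (p+1)×(p+1) integer message matrix M, the code matrix E = M·G_n satisfies det(E) = (−1)^{n(p+2)} · det(M). In particular, det(E) = −det(M) when n is odd and p is odd, and det(E) = det(M) when n(p+2) is even. -/
theorem pellCompanion_apply_last {p : ℕ} (hp : 1 ≤ p) (i : Fin (p + 1)) :
    pellCompanion p i (Fin.last p) = if i = 0 then 1 else 0 := by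
  have hi := i.isLt
  simp only [pellCompanion, Fin.val_last, Fin.ext_iff, Fin.val_zero]
  grind

theorem pellCompanion_submatrix (p : ℕ) :
    (pellCompanion p).submatrix Fin.succ Fin.castSucc = 1 := by
  ext i j
  simp [pellCompanion, Matrix.one_apply, Fin.ext_iff]

theorem det_pellCompanion {p : ℕ} (hp : 1 ≤ p) : (pellCompanion p).det = (-1) ^ p := by
  rw [Matrix.det_succ_column _ (Fin.last p), Finset.sum_eq_single 0]
  · simp [pellCompanion_submatrix, pellCompanion_apply_last hp]
  · intro i _ hi
    simp [pellCompanion_apply_last hp, hi]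
  · simp

/-- For `p ≥ 1` and `n ≥ 1`, the code matrix `E = M * G_n` (with
`G_n = A^n`) satisfies `det E = (-1)^(n*(p+2)) * det M`; in particular
`det E = -det M` when `n` and `p` are odd, and `det E = det M` when
`n*(p+2)` is even. -/
theorem pellCoding_det (p n : ℕ) (hp : 1 ≤ p) (hn : 1 ≤ n)
    (M : Matrix (Fin (p + 1)) (Fin (p + 1)) ℤ) :
    (M * (pellCompanion p ^ n)).det = (-1 : ℤ) ^ (n * (p + 2)) * M.det ∧
    (Odd n → Odd p → (M * (pellCompanion p ^ n)).det = -M.det) ∧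
    (Even (n * (p + 2)) → (M * (pellCompanion p ^ n)).det = M.det) := by
  have key : (M * (pellCompanion p ^ n)).det = (-1 : ℤ) ^ (n * (p + 2)) * M.det := by
    rw [Matrix.det_mul, Matrix.det_pow, det_pellCompanion hp, ← pow_mul, mul_comm M.det,
      mul_comm p n, mul_add, pow_add, (even_two.mul_left n).neg_one_pow, mul_one]
  refine ⟨key, fun hodd_n hodd_p => ?_, fun heven => ?_⟩
  · rw [key, (hodd_n.mul (hodd_p.add_even even_two)).neg_one_pow, neg_one_mul]
  · rw [key, heven.neg_one_pow, one_mul]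
end

section
/- Let n ≥ 3 be an odd integer and let m_1, m_2 be positive integers. Define e_1 = m_1·P_{n+1} + m_2·P_n and e_2 = m_1·P_n + m_2·P_{n−1}, where P_k is the k-th Pell number. Then the ratio of code entries satisfies the strict inequalities P_{n+1}/P_n < e_1/e_2 < P_n/P_{n−1} (as rational numbers). -/
/-- The Pell numbers: `P 0 = 0`, `P 1 = 1`, `P (n+2) = 2 * P (n+1) + P n`. -/
def pell : ℕ → ℤ
  | 0 => 0
  | 1 => 1
  | n + 2 => 2 * pell (n + 1) + pell n

theorem pell_succ_pos (n : ℕ) : 0 < pell (n + 1) := by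
  induction n using Nat.twoStepInduction with
  | zero => decide
  | one => decide
  | more n h₁ h₂ =>
    rw [pell]
    linarith

/-- Cassini's identity for the Pell numbers. -/
theorem pell_mul_pell_sub_sq (n : ℕ) :
    pell (n + 2) * pell n - pell (n + 1) ^ 2 = (-1) ^ (n + 1) := by
  induction n with
  | zero => decide
  | succ n ih =>
    have h₂ : pell (n + 2) = 2 * pell (n + 1) + pell n := rfl
    have h₃ : pell (n + 1 + 2) = 2 * pell (n + 2) + pell (n + 1) := rfl
    rw [pow_succ (-1), ← ih, h₃, show n + 1 + 1 = n + 2 from rfl, h₂]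
    ring

/-- For odd `n ≥ 3` and positive integers `m₁, m₂`, the code entries
`e₁ = m₁ P_{n+1} + m₂ P_n`, `e₂ = m₁ P_n + m₂ P_{n-1}` satisfy
`P_{n+1}/P_n < e₁/e₂ < P_n/P_{n-1}`. -/
theorem pell_code_ratio_odd (n : ℕ) (hn : 3 ≤ n) (hodd : Odd n)
    (m₁ m₂ : ℤ) (hm₁ : 0 < m₁) (hm₂ : 0 < m₂) :
    (pell (n + 1) : ℚ) / (pell n : ℚ) <
        ((m₁ * pell (n + 1) + m₂ * pell n : ℤ) : ℚ) /
          ((m₁ * pell n + m₂ * pell (n - 1) : ℤ) : ℚ) ∧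
    ((m₁ * pell (n + 1) + m₂ * pell n : ℤ) : ℚ) /
        ((m₁ * pell n + m₂ * pell (n - 1) : ℤ) : ℚ) <
      (pell n : ℚ) / (pell (n - 1) : ℚ) := by
  obtain ⟨k, rfl⟩ : ∃ k, n = k + 2 := ⟨n - 2, by lia⟩
  have cassini := pell_mul_pell_sub_sq (k + 1)
  rw [show k + 1 + 1 = k + 2 from rfl, hodd.neg_one_pow] at cassini
  have hlt : pell (k + 2 + 1) * pell (k + 1) < pell (k + 2) * pell (k + 2) := by
    linarith
  have hb : 0 < pell (k + 2) := pell_succ_pos (k + 1)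
  have hc : 0 < pell (k + 1) := pell_succ_pos k
  have he : 0 < m₁ * pell (k + 2) + m₂ * pell (k + 1) := by positivity
  rw [show k + 2 - 1 = k + 1 from rfl,
    div_lt_div_iff₀ (Int.cast_pos.2 hb) (Int.cast_pos.2 he),
    div_lt_div_iff₀ (Int.cast_pos.2 he) (Int.cast_pos.2 hc)]
  norm_cast
  constructor
  · linarith [mul_lt_mul_of_pos_left hlt hm₂]
  · linarith [mul_lt_mul_of_pos_left hlt hm₁]
end

section
/- Let n ≥ 1, let M = [[m_1, m_2], [m_3, m_4]] be a 2×2 integer matrix, and let E = M·G_n = [[e_1, e_2], [e_3, e_4]] where G_n = [[P_{n+1}, P_n], [P_n, P_{n−1}]] and P_k is the k-th Pell number. Then the code entries satisfy e_1·e_4 − e_2·e_3 = (−1)^n·det(M); consequently, if e_4 ≠ 0 then e_1 = ((−1)^n·det(M) + e_2·e_3)/e_4, if e_1 ≠ 0 then e_4 = ((−1)^n·det(M) + e_2·e_3)/e_1, if e_3 ≠ 0 then e_2 = (e_1·e_4 − (−1)^n·det(M))/e_3, and if e_2 ≠ 0 then e_3 = (e_1·e_4 − (−1)^n·det(M))/e_2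 (as rational numbers). Thus any single damaged entry of the code matrix is determined by the other three entries together with det(M). -/
/-- Cassini's identity for the Pell numbers. -/
theorem pell_cassini (k : ℕ) :
    pell (k + 2) * pell k - pell (k + 1) * pell (k + 1) = (-1) ^ (k + 1) := by
  induction k with
  | zero => simp [pell]
  | succ k ih =>
    have h₁ : pell (k + 3) = 2 * pell (k + 2) + pell (k + 1) := rfl
    have h₂ : pell (k + 2) = 2 * pell (k + 1) + pell k := rfl
    rw [pow_succ, ← ih, show k + 1 + 2 = k + 3 from rfl, show k + 1 + 1 = k + 2 from rfl, h₁, h₂]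
    ring

/-- For `n ≥ 1` and the code matrix `E = M * G_n` (with
`G_n = [[P_{n+1}, P_n], [P_n, P_{n-1}]]`), the entries satisfy
`e₁ e₄ - e₂ e₃ = (-1)^n det M`, and consequently each single entry is
determined (as a rational number) by the other three entries and `det M`. -/
theorem pell_code_error_correction (n : ℕ) (hn : 1 ≤ n)
    (m₁ m₂ m₃ m₄ e₁ e₂ e₃ e₄ : ℤ)
    (hE : !![m₁, m₂; m₃, m₄] *
        !![pell (n + 1), pell n; pell n, pell (n - 1)] = !![e₁, e₂; e₃, e₄]) :
    e₁ * e₄ - e₂ * e₃ = (-1 : ℤ) ^ n * (m₁ * m₄ - m₂ * m₃) ∧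
    (e₄ ≠ 0 → (e₁ : ℚ) =
      (((-1 : ℤ) ^ n * (m₁ * m₄ - m₂ * m₃) + e₂ * e₃ : ℤ) : ℚ) / (e₄ : ℚ)) ∧
    (e₁ ≠ 0 → (e₄ : ℚ) =
      (((-1 : ℤ) ^ n * (m₁ * m₄ - m₂ * m₃) + e₂ * e₃ : ℤ) : ℚ) / (e₁ : ℚ)) ∧
    (e₃ ≠ 0 → (e₂ : ℚ) =
      ((e₁ * e₄ - (-1 : ℤ) ^ n * (m₁ * m₄ - m₂ * m₃) : ℤ) : ℚ) / (e₃ : ℚ)) ∧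
    (e₂ ≠ 0 → (e₃ : ℚ) =
      ((e₁ * e₄ - (-1 : ℤ) ^ n * (m₁ * m₄ - m₂ * m₃) : ℤ) : ℚ) / (e₂ : ℚ)) := by
  have hdet : e₁ * e₄ - e₂ * e₃ = (-1 : ℤ) ^ n * (m₁ * m₄ - m₂ * m₃) := by
    obtain ⟨k, rfl⟩ := Nat.exists_eq_add_of_le' hn
    have h := congrArg Matrix.det hE
    rw [Matrix.det_mul, Matrix.det_fin_two_of, Matrix.det_fin_two_of, Matrix.det_fin_two_of,
      Nat.add_sub_cancel, pell_cassini] at h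
    rw [← h, mul_comm]
  refine ⟨hdet, fun h => ?_, fun h => ?_, fun h => ?_, fun h => ?_⟩ <;>
  · rw [eq_div_iff (Int.cast_ne_zero.mpr h), ← hdet]
    push_cast
    ring
end
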